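/- Let $T>0$, let $q\ge2$ be an integer, and let $\tfrac23<H<\tfrac34$. Then $\int_{[0,T]^3} G^{(q)}_{0,x}(u_1,u_2)\, dx\, du_1\, du_2 < \infty$, i.e. the function $(x,u_1,u_2)\mapsto G^{(q)}_{0,x}(u_1,u_2) = u_1^{-2H(\frac12+q)\cdot\frac{1}{1}}\,$ (explicitly $u_1^{-(1+2q)H}u_2^{-(1+2q)H}\mu_H(x,u_1,u_2)^{2q-1}$) is integrable on $(0,T)^3$. -/

import Mathlib

open Real Set MeasureTheory

/-- The covariance `𝔼[B_{u₁}(B_{x+u₂} - B_x)]` of a fractional Brownian motion of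
Hurst parameter `H`. -/
noncomputable def mu (H x u₁ u₂ : ℝ) : ℝ :=
  (1/2) * ((x + u₂) ^ (2*H) - x ^ (2*H) - |x + u₂ - u₁| ^ (2*H) + |x - u₁| ^ (2*H))

/-- The kernel `G^{(q)}_{ε,x}(u₁,u₂) = (ε + u₁^{2H})^{-1/2-q} (ε + u₂^{2H})^{-1/2-q}
μ_H(x,u₁,u₂)^{2q-1}`. -/
noncomputable def G (H : ℝ) (q : ℕ) (ε x u₁ u₂ : ℝ) : ℝ :=
  (ε + u₁ ^ (2*H)) ^ (-(1/2 : ℝ) - (q : ℝ)) * (ε + u₂ ^ (2*H)) ^ (-(1/2 : ℝ) - (q : ℝ)) *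
    mu H x u₁ u₂ ^ (2*q - 1)

lemma abs_rpow_sub_le {p R a b : ℝ} (hp : 1 < p) (ha : |a| ≤ R) (hb : |b| ≤ R) :
    |(|a| ^ p - |b| ^ p)| ≤ p * R ^ (p - 1) * |a - b| := by
  have hderiv : ∀ y ∈ Icc (-R) R,
      HasDerivWithinAt (fun y : ℝ => |y| ^ p) (p * |y| ^ (p - 2) * y) (Icc (-R) R) y :=
    fun y _ => (hasDerivAt_abs_rpow y hp).hasDerivWithinAt
  refine (convex_Icc (-R) R).norm_image_sub_le_of_norm_hasDerivWithin_le hderiv ?_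
    (abs_le.1 hb) (abs_le.1 ha)
  intro y hy
  have hyR : |y| ≤ R := abs_le.2 hy
  rcases eq_or_ne y 0 with rfl | hy0
  · have : 0 ≤ R := (abs_nonneg _).trans hyR
    simp only [mul_zero, norm_zero]
    positivity
  · have hpos : 0 < |y| := abs_pos.2 hy0
    rw [norm_mul, norm_mul, Real.norm_eq_abs, Real.norm_eq_abs, Real.norm_eq_abs,
      abs_of_pos (by linarith : 0 < p), abs_of_pos (rpow_pos_of_pos hpos _), mul_assoc,
      ← rpow_add_one hpos.ne', show p - 2 + 1 = p - 1 by ring]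
    gcongr

lemma abs_rpow_sub_rpow_le {r c a b : ℝ} (hr0 : 0 ≤ r) (hr1 : r ≤ 1) (hc : 0 < c)
    (ha : c ≤ a) (hb : c ≤ b) : |a ^ r - b ^ r| ≤ r * c ^ (r - 1) * |a - b| := by
  have hderiv : ∀ y ∈ Ici c,
      HasDerivWithinAt (fun y : ℝ => y ^ r) (r * y ^ (r - 1)) (Ici c) y := fun y hy =>
    (hasDerivAt_rpow_const (Or.inl (hc.trans_le hy).ne')).hasDerivWithinAt
  refine (convex_Ici c).norm_image_sub_le_of_norm_hasDerivWithin_le hderiv ?_ hb ha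
  intro y hy
  have hy0 : 0 < y := hc.trans_le hy
  rw [norm_mul, Real.norm_eq_abs, Real.norm_eq_abs, abs_of_nonneg hr0,
    abs_of_pos (rpow_pos_of_pos hy0 _)]
  exact mul_le_mul_of_nonneg_left (rpow_le_rpow_of_nonpos hc hy (by linarith)) hr0

lemma abs_second_difference_rpow_le {p c x u v : ℝ} (hp1 : 1 ≤ p) (hp2 : p ≤ 2) (hc : 0 < c)
    (hu : 0 ≤ u) (hv : 0 ≤ v) (hx : c ≤ x - u) :
    |(x + v) ^ p - x ^ p - (x + v - u) ^ p + (x - u) ^ p| ≤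
      p * (p - 1) * c ^ (p - 2) * u * v := by
  have hderiv : ∀ t ∈ Icc 0 v, HasDerivWithinAt
      (fun t : ℝ => (x + t) ^ p - (x - u + t) ^ p)
      (1 * p * (x + t) ^ (p - 1) - 1 * p * (x - u + t) ^ (p - 1)) (Icc 0 v) t := by
    intro t ht
    exact ((((hasDerivAt_id t).const_add x).rpow_const
      (Or.inl (by simp only [id]; linarith [ht.1]))).sub
      (((hasDerivAt_id t).const_add (x - u)).rpow_const
      (Or.inl (by simp only [id]; linarith [ht.1])))).hasDerivWithinAt
  have hbound : ∀ t ∈ Icc 0 v,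
      ‖1 * p * (x + t) ^ (p - 1) - 1 * p * (x - u + t) ^ (p - 1)‖ ≤
        p * (p - 1) * c ^ (p - 2) * u := by
    intro t ht
    have h := abs_rpow_sub_rpow_le (r := p - 1) (a := x + t) (b := x - u + t)
      (by linarith) (by linarith) hc (by linarith [ht.1]) (by linarith [ht.1])
    rw [show x + t - (x - u + t) = u by ring, abs_of_nonneg hu,
      show p - 1 - 1 = p - 2 by ring] at h
    rw [one_mul, ← mul_sub, norm_mul, Real.norm_eq_abs, Real.norm_eq_abs,
      abs_of_nonneg (by linarith : 0 ≤ p)]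
    calc p * |(x + t) ^ (p - 1) - (x - u + t) ^ (p - 1)|
        ≤ p * ((p - 1) * c ^ (p - 2) * u) := by gcongr
      _ = _ := by ring
  have h := (convex_Icc 0 v).norm_image_sub_le_of_norm_hasDerivWithin_le hderiv hbound
    (left_mem_Icc.2 hv) (right_mem_Icc.2 hv)
  simp only [add_zero, sub_zero, Real.norm_eq_abs, abs_of_nonneg hv] at h
  convert h using 2
  rw [show x - u + v = x + v - u by ring]
  ring

lemma abs_second_difference_abs_rpow_le {p M x u v : ℝ} (hp : 1 < p) (hx0 : 0 ≤ x)
    (hu : 0 ≤ u) (hv : 0 ≤ v) (hx : x ≤ 2 * M) (huM : u ≤ M) (hvM : v ≤ M) :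
    |(x + v) ^ p - x ^ p - |x + v - u| ^ p + |x - u| ^ p| ≤
      2 * p * (4 * M) ^ (p - 1) * min u v := by
  have h1 : |x + v| ≤ 4 * M := by rw [abs_le]; constructor <;> linarith
  have h2 : |x| ≤ 4 * M := by rw [abs_le]; constructor <;> linarith
  have h3 : |x + v - u| ≤ 4 * M := by rw [abs_le]; constructor <;> linarith
  have h4 : |x - u| ≤ 4 * M := by rw [abs_le]; constructor <;> linarith
  have h12 := abs_rpow_sub_le hp h1 h2
  have h34 := abs_rpow_sub_le hp h3 h4
  have h13 := abs_rpow_sub_le hp h1 h3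
  have h24 := abs_rpow_sub_le hp h2 h4
  rw [show x + v - x = v by ring, abs_of_nonneg hv] at h12
  rw [show x + v - u - (x - u) = v by ring, abs_of_nonneg hv] at h34
  rw [show x + v - (x + v - u) = u by ring, abs_of_nonneg hu] at h13
  rw [show x - (x - u) = u by ring, abs_of_nonneg hu] at h24
  rw [abs_of_nonneg (add_nonneg hx0 hv)] at h12 h13
  rw [abs_of_nonneg hx0] at h12 h24
  rw [abs_le] at h12 h34 h13 h24 ⊢
  rcases min_choice u v with h | h <;> rw [h] <;> constructor <;> linarith

lemma div_two_rpow_le {s N : ℝ} (hs0 : -1 ≤ s) (hN : 0 < N) :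
    (N / 2) ^ s ≤ 2 * N ^ s := by
  rw [div_rpow hN.le zero_le_two, div_eq_mul_inv, ← rpow_neg zero_le_two, mul_comm]
  gcongr
  calc (2 : ℝ) ^ (-s) ≤ 2 ^ (1 : ℝ) := rpow_le_rpow_of_exponent_le one_le_two (by linarith)
    _ = 2 := rpow_one 2

lemma abs_mu_le {H x u v : ℝ} (hH : 1 / 2 < H) (hH1 : H ≤ 1) (hx : 0 < x)
    (hu : 0 < u) (hv : 0 < v) :
    |mu H x u v| ≤ 16 * u * v * (max x (max u v)) ^ (2 * H - 2) := by
  rw [mu, abs_mul, abs_of_pos (by norm_num : (0 : ℝ) < 1 / 2)]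
  set N := max x (max u v) with hN
  have hN0 : 0 < N := lt_max_of_lt_left hx
  have hNs := div_two_rpow_le (s := 2 * H - 2) (by linarith) hN0
  have hNpos : 0 < N ^ (2 * H - 2) := rpow_pos_of_pos hN0 _
  have huv : 0 < u * v := mul_pos hu hv
  rcases le_total (2 * max u v) x with h | h
  · have huM : u ≤ max u v := le_max_left u v
    have hNx : N = x := max_eq_left (by linarith)
    have hvM : v ≤ max u v := le_max_right u v
    have hd := abs_second_difference_rpow_le (p := 2 * H) (c := x / 2) (x := x) (by linarith)
      (by linarith) (by linarith) hu.le hv.le (by linarith)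
    rw [abs_of_nonneg (by linarith : 0 ≤ x + v - u), abs_of_nonneg (by linarith : 0 ≤ x - u)]
    rw [hNx] at hNs hNpos ⊢
    have hHH : 2 * H * (2 * H - 1) ≤ 2 := by nlinarith
    have hmain : 2 * H * (2 * H - 1) * (x / 2) ^ (2 * H - 2) * u * v ≤
        2 * (2 * x ^ (2 * H - 2)) * u * v := by gcongr
    nlinarith [mul_pos huv hNpos]
  · set M := max u v with hM
    have hM0 : 0 < M := lt_max_of_lt_left hu
    have hd := abs_second_difference_abs_rpow_le (p := 2 * H) (by linarith) hx.le hu.le hv.le h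
      (le_max_left u v) (le_max_right u v)
    have hNM : N / 2 ≤ M := by
      rw [div_le_iff₀ two_pos]; exact max_le (by linarith) (by linarith)
    have hMs : M ^ (2 * H - 2) ≤ (N / 2) ^ (2 * H - 2) :=
      rpow_le_rpow_of_nonpos (by linarith) hNM (by linarith)
    have h4 : (4 * M) ^ (2 * H - 1) ≤ 4 * (M * M ^ (2 * H - 2)) := by
      rw [mul_rpow (by norm_num) hM0.le]
      have e : M ^ (2 * H - 1) = M * M ^ (2 * H - 2) := by
        rw [mul_comm M, ← rpow_add_one hM0.ne']; congr 1; ring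
      rw [e]
      gcongr
      calc (4 : ℝ) ^ (2 * H - 1) ≤ 4 ^ (1 : ℝ) :=
            rpow_le_rpow_of_exponent_le (by norm_num) (by linarith)
        _ = 4 := rpow_one 4
    have hmM : min u v * M = u * v := min_mul_max u v
    have hm0 : 0 < min u v := lt_min hu hv
    calc 1 / 2 * _ ≤ 1 / 2 * (2 * (2 * H) * (4 * M) ^ (2 * H - 1) * min u v) := by gcongr
      _ ≤ 1 / 2 * (2 * (2 * 1) * (4 * (M * (2 * N ^ (2 * H - 2)))) * min u v) := by
          gcongr
          exact h4.trans (by gcongr; exact hMs.trans hNs)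
      _ = 16 * (min u v * M) * N ^ (2 * H - 2) := by ring
      _ = _ := by rw [hmM]; ring

lemma rpow_neg_max_le {x u v b c : ℝ} (hx : 0 < x) (hu : 0 < u) (hv : 0 < v)
    (hb : 0 ≤ b) (hc : 0 ≤ c) :
    (max x (max u v)) ^ (-(b + 2 * c)) ≤ x ^ (-b) * u ^ (-c) * v ^ (-c) := by
  set N := max x (max u v) with hN
  have hN0 : 0 < N := lt_max_of_lt_left hx
  have hNx : x ≤ N := le_max_left _ _
  have hNu : u ≤ N := (le_max_left _ _).trans (le_max_right _ _)
  have hNv : v ≤ N := (le_max_right _ _).trans (le_max_right _ _)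
  rw [show -(b + 2 * c) = -b + -c + -c by ring, rpow_add hN0, rpow_add hN0]
  gcongr ?_ * ?_ * ?_
  · exact rpow_le_rpow_of_nonpos hx hNx (by linarith)
  · exact rpow_le_rpow_of_nonpos hu hNu (by linarith)
  · exact rpow_le_rpow_of_nonpos hv hNv (by linarith)

lemma abs_G_zero_le {H x u v b c : ℝ} {q : ℕ} (hq : 1 ≤ q) (hH : 1 / 2 < H) (hH1 : H ≤ 1)
    (hx : 0 < x) (hu : 0 < u) (hv : 0 < v) (hb : 0 ≤ b) (hc : 0 ≤ c)
    (hbc : b + 2 * c = (2 - 2 * H) * (2 * q - 1)) :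
    |G H q 0 x u v| ≤ 16 ^ (2 * q - 1) * (x ^ (-b) *
      (u ^ (2 * q - 1 - (1 + 2 * q) * H - c) * v ^ (2 * q - 1 - (1 + 2 * q) * H - c))) := by
  set N := max x (max u v) with hN
  have hN0 : 0 < N := lt_max_of_lt_left hx
  have hcast : ((2 * q - 1 : ℕ) : ℝ) = 2 * q - 1 := by
    rw [Nat.cast_sub (by omega)]; push_cast; ring
  have hsplit : ∀ w : ℝ, 0 < w → w ^ (2 * q - 1 - (1 + 2 * q) * H - c) =
      w ^ (2 * H * (-(1 / 2) - q)) * w ^ (2 * q - 1) * w ^ (-c) := by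
    intro w hw
    rw [← rpow_natCast, hcast, ← rpow_add hw, ← rpow_add hw]
    congr 1; ring
  have hNpow : (N ^ (2 * H - 2)) ^ (2 * q - 1) = N ^ (-(b + 2 * c)) := by
    rw [← rpow_natCast, hcast, ← rpow_mul hN0.le, hbc]
    congr 1; ring
  rw [G, zero_add, zero_add, ← rpow_mul hu.le, ← rpow_mul hv.le, abs_mul, abs_mul, abs_pow,
    abs_of_pos (rpow_pos_of_pos hu _), abs_of_pos (rpow_pos_of_pos hv _), hsplit u hu,
    hsplit v hv]
  calc u ^ (2 * H * (-(1 / 2) - q)) * v ^ (2 * H * (-(1 / 2) - q)) * |mu H x u v| ^ (2 * q - 1)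
      ≤ u ^ (2 * H * (-(1 / 2) - q)) * v ^ (2 * H * (-(1 / 2) - q)) *
          (16 * u * v * N ^ (2 * H - 2)) ^ (2 * q - 1) := by
        gcongr
        exact abs_mu_le hH hH1 hx hu hv
    _ = u ^ (2 * H * (-(1 / 2) - q)) * v ^ (2 * H * (-(1 / 2) - q)) *
          (16 ^ (2 * q - 1) * u ^ (2 * q - 1) * v ^ (2 * q - 1) * N ^ (-(b + 2 * c))) := by
        rw [mul_pow, mul_pow, mul_pow, hNpow]
    _ ≤ u ^ (2 * H * (-(1 / 2) - q)) * v ^ (2 * H * (-(1 / 2) - q)) *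
          (16 ^ (2 * q - 1) * u ^ (2 * q - 1) * v ^ (2 * q - 1) *
            (x ^ (-b) * u ^ (-c) * v ^ (-c))) := by
        gcongr
        exact rpow_neg_max_le hx hu hv hb hc
    _ = _ := by ring

lemma integrableOn_Ioo_rpow {T s : ℝ} (hT : 0 < T) (hs : -1 < s) :
    IntegrableOn (fun y : ℝ => y ^ s) (Ioo 0 T) :=
  (intervalIntegral.integrableOn_Ioo_rpow_iff hT).2 hs

lemma measurable_G (H : ℝ) (q : ℕ) (ε : ℝ) :
    Measurable (fun p : ℝ × ℝ × ℝ => G H q ε p.1 p.2.1 p.2.2) := by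
  unfold G mu
  fun_prop

/-- For `q ≥ 2` and `2/3 < H < 3/4`, the function
`(x,u₁,u₂) ↦ G^{(q)}_{0,x}(u₁,u₂) = u₁^{-(1+2q)H} u₂^{-(1+2q)H} μ_H(x,u₁,u₂)^{2q-1}`
is integrable on `(0,T)³`. -/
theorem G_zero_integrable (T : ℝ) (hT : 0 < T) (q : ℕ) (hq : 2 ≤ q) (H : ℝ)
    (hH : H ∈ Ioo (2/3 : ℝ) (3/4 : ℝ)) :
    IntegrableOn (fun p : ℝ × ℝ × ℝ => G H q 0 p.1 p.2.1 p.2.2)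
      (Ioo (0:ℝ) T ×ˢ Ioo (0:ℝ) T ×ˢ Ioo (0:ℝ) T) volume := by
  obtain ⟨hH1, hH2⟩ := hH
  have hq2 : (2 : ℝ) ≤ q := by exact_mod_cast hq
  set A : ℝ := 2 * q - (1 + 2 * q) * H with hA
  have hA0 : 0 < A := by nlinarith
  set S : ℝ := (2 - 2 * H) * (2 * q - 1) with hS
  have hS0 : 0 < S := mul_pos (by linarith) (by linarith)
  have hSA : S < 1 + 2 * A := by rw [hS, hA]; nlinarith
  set θ : ℝ := S / (1 + 2 * A) with hθ
  have hθ0 : 0 < θ := by positivity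
  have hθ1 : θ < 1 := (div_lt_one (by linarith)).2 hSA
  have hbc : θ + 2 * (θ * A) = S := by rw [hθ]; field_simp
  have hθA : θ * A < A := by nlinarith
  have hx := integrableOn_Ioo_rpow (s := -θ) hT (by linarith)
  have hu := integrableOn_Ioo_rpow (s := 2 * q - 1 - (1 + 2 * q) * H - θ * A) hT (by linarith)
  have hdom := (Integrable.mul_prod hx (Integrable.mul_prod hu hu)).const_mul (16 ^ (2 * q - 1))
  rw [Measure.prod_restrict, Measure.prod_restrict] at hdom
  refine Integrable.mono' hdom (measurable_G H q 0).aestronglyMeasurable ?_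
  refine (ae_restrict_iff' (measurableSet_Ioo.prod (measurableSet_Ioo.prod measurableSet_Ioo))).2
    (Filter.Eventually.of_forall ?_)
  rintro ⟨x, u, v⟩ ⟨hx, hu, hv⟩
  exact abs_G_zero_le (by omega) (by linarith) (by linarith) hx.1 hu.1 hv.1 hθ0.le
    (by positivity) hbc
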